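/- There is an absolute constant C > 0 such that for every k ≥ 1, every G ≥ 0, and every function f : [k] × [k] → ℝ satisfying |f(i, j) − f(i, j')| ≤ G·|j − j'| for all i, j, j' ∈ [k] and |f(i, j)| ≤ G·k for all i, j ∈ [k], there exist matrices L, R ∈ ℝ^{k×k} such that LᵀR = W^f and ‖L‖_{1→2}·‖R‖_{1→2} ≤ C·G·k, where W^f ∈ ℝ^{k×k} is the matrix with entries (W^f)_{i,j} = f(i, j). -/

import Mathlib

/-- `‖A‖_{1→2}`: the maximum Euclidean norm of a column. -/
noncomputable def norm1to2 {ι κ : Type} [Fintype ι] [Fintype κ] (A : Matrix ι κ ℝ) : ℝ :=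
  ⨆ j : κ, Real.sqrt (∑ i : ι, (A i j) ^ 2)

theorem norm1to2_le_sqrt {ι κ : Type} [Fintype ι] [Fintype κ] [Nonempty κ]
    (A : Matrix ι κ ℝ) {c : ℝ} (h : ∀ j, ∑ i, A i j ^ 2 ≤ c) : norm1to2 A ≤ √c :=
  ciSup_le fun j => Real.sqrt_le_sqrt (h j)

theorem norm1to2_nonneg {ι κ : Type} [Fintype ι] [Fintype κ] (A : Matrix ι κ ℝ) :
    0 ≤ norm1to2 A :=
  Real.iSup_nonneg fun _ => Real.sqrt_nonneg _

theorem Fin.sum_sub_mul_ite_castSucc_lt {n : ℕ} (g : Fin (n + 1) → ℝ) (j : Fin (n + 1)) :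
    ∑ m : Fin n, (g m.succ - g m.castSucc) * (if m.castSucc < j then 1 else 0) = g j - g 0 := by
  induction j using Fin.induction with
  | zero => simp
  | succ j ih =>
    have step : ∀ m : Fin n, (if m.castSucc < j.succ then (1 : ℝ) else 0) =
        (if m.castSucc < j.castSucc then 1 else 0) + if m = j then 1 else 0 := by
      intro m
      simp only [Fin.lt_def, Fin.ext_iff, Fin.val_castSucc, Fin.val_succ]
      split_ifs <;> first | omega | norm_num
    simp only [step, mul_add, Finset.sum_add_distrib, ih]
    simp

/-- Lemma 6 (factorization of Lipschitz kernels): if `f` is `G`-Lipschitz in its second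
argument and `|f| ≤ Gk`, then `W^f` admits a factorization `LᵀR = W^f` with
`‖L‖_{1→2} ‖R‖_{1→2} ≤ C G k`; in particular `γ₂(W^f) ≤ C G k`. -/
theorem lipschitz_kernel_factorization :
    ∃ C : ℝ, 0 < C ∧
      ∀ k : ℕ, 1 ≤ k →
        ∀ G : ℝ, 0 ≤ G →
          ∀ f : Fin k → Fin k → ℝ,
            (∀ i j j' : Fin k, |f i j - f i j'| ≤ G * |(j : ℝ) - (j' : ℝ)|) →
            (∀ i j : Fin k, |f i j| ≤ G * k) →
            ∃ L R : Matrix (Fin k) (Fin k) ℝ,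
              L.transpose * R = Matrix.of f ∧ norm1to2 L * norm1to2 R ≤ C * G * k := by
  refine ⟨2, two_pos, ?_⟩
  rintro (_ | n) hk G hG f hLip hBd
  · omega
  set K : ℝ := ((n + 1 : ℕ) : ℝ) with hK
  have hK0 : 0 < K := by positivity
  have hKn : (n : ℝ) ≤ K := by simp [hK]
  have hs : √K ^ 2 = K := Real.sq_sqrt hK0.le
  have hs0 : √K ≠ 0 := (Real.sqrt_pos.2 hK0).ne'
  let L : Matrix (Fin (n + 1)) (Fin (n + 1)) ℝ := Matrix.of fun m i =>
    Fin.cases (motive := fun _ => ℝ) (f i 0 / √K) (fun m => f i m.succ - f i m.castSucc) m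
  let R : Matrix (Fin (n + 1)) (Fin (n + 1)) ℝ := Matrix.of fun m j =>
    Fin.cases (motive := fun _ => ℝ) (√K) (fun m => if m.castSucc < j then 1 else 0) m
  refine ⟨L, R, ?_, ?_⟩
  · ext i j
    simp only [Matrix.mul_apply, Matrix.transpose_apply, Fin.sum_univ_succ, L, R, Matrix.of_apply,
      Fin.cases_zero, Fin.cases_succ, Fin.sum_sub_mul_ite_castSucc_lt (f i) j]
    field_simp
    ring
  · have hL : norm1to2 L ≤ √(2 * G ^ 2 * K) := by
      refine norm1to2_le_sqrt L fun i => ?_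
      simp only [Fin.sum_univ_succ, L, Matrix.of_apply, Fin.cases_zero, Fin.cases_succ]
      have h0 : (f i 0 / √K) ^ 2 ≤ G ^ 2 * K := by
        rw [div_pow, hs, div_le_iff₀ hK0]
        calc f i 0 ^ 2 = |f i 0| ^ 2 := (sq_abs _).symm
          _ ≤ (G * K) ^ 2 := by gcongr; exact hBd i 0
          _ = G ^ 2 * K * K := by ring
      have h1 : ∑ m : Fin n, (f i m.succ - f i m.castSucc) ^ 2 ≤ n * G ^ 2 := by
        have hdiff : ∀ m : Fin n, (f i m.succ - f i m.castSucc) ^ 2 ≤ G ^ 2 := fun m => by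
          have := hLip i m.succ m.castSucc
          rw [← sq_abs]
          gcongr
          simpa using this
        simpa using Finset.sum_le_sum fun m (_ : m ∈ Finset.univ) => hdiff m
      nlinarith [mul_le_mul_of_nonneg_right hKn (sq_nonneg G)]
    have hR : norm1to2 R ≤ √(2 * K) := by
      refine norm1to2_le_sqrt R fun j => ?_
      simp only [Fin.sum_univ_succ, R, Matrix.of_apply, Fin.cases_zero, Fin.cases_succ, hs]
      have h1 : ∑ m : Fin n, (if m.castSucc < j then (1 : ℝ) else 0) ^ 2 ≤ n := by
        have hite : ∀ m : Fin n, (if m.castSucc < j then (1 : ℝ) else 0) ^ 2 ≤ 1 := fun m => by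
          split_ifs <;> norm_num
        simpa using Finset.sum_le_sum fun m (_ : m ∈ Finset.univ) => hite m
      linarith
    calc norm1to2 L * norm1to2 R ≤ √(2 * G ^ 2 * K) * √(2 * K) :=
          mul_le_mul hL hR (norm1to2_nonneg R) (Real.sqrt_nonneg _)
      _ = √((2 * G * K) ^ 2) := by
          rw [← Real.sqrt_mul (by positivity)]
          ring_nf
      _ = 2 * G * K := Real.sqrt_sq (by positivity)
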